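/- Let Φ : ℂ₊ → ℂ₊ be holomorphic and suppose the composition operator C_Φ : F ↦ F ∘ Φ is bounded on the Bergman space A²(ℂ₊) of the right half-plane. Then C_Φ is bounded below if and only if there is a constant C > 0 such that ‖C_Φ K̃_w‖ ≥ C for all w ∈ ℂ₊, where K̃_w is the normalized reproducing kernel of A²(ℂ₊) at w. -/

import Mathlib

open MeasureTheory Metric Complex

noncomputable section

/-- The Bergman space norm on the right half-plane:
`‖F‖ = (∫_{ℂ₊} ‖F(s)‖² dA(s))^{1/2}` (area measure). -/
def hpBergNorm (F : ℂ → ℂ) : ℝ :=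
  Real.sqrt (∫ s in {s : ℂ | 0 < s.re}, ‖F s‖ ^ 2)

/-- Membership in the Bergman space `A²(ℂ₊)` of the right half-plane. -/
def MemA2Plane (F : ℂ → ℂ) : Prop :=
  DifferentiableOn ℂ F {s : ℂ | 0 < s.re} ∧
    IntegrableOn (fun s => ‖F s‖ ^ 2) {s : ℂ | 0 < s.re}

/-- The normalized reproducing kernel of `A²(ℂ₊)` at `w`: the kernel
`K_w(s) = c/(s + conj w)²` divided by its norm. -/
def bergKtildePlane (w s : ℂ) : ℂ :=
  (((s + (starRingEnd ℂ) w) ^ 2)⁻¹) /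
    ((hpBergNorm fun u => ((u + (starRingEnd ℂ) w) ^ 2)⁻¹ : ℝ) : ℂ)

/-- The open right half-plane. -/
abbrev rightHalfPlane : Set ℂ := {s : ℂ | 0 < s.re}

lemma isOpen_rightHalfPlane : IsOpen rightHalfPlane := isOpen_lt continuous_const continuous_re


/-! ### Integration over discs -/

lemma lintegral_ball_eq_polar (f : ℂ → ENNReal) (hf : Measurable f) (c : ℂ) (r : ℝ) :
    ∫⁻ z in ball c r, f z = ∫⁻ ρ in Set.Ioo 0 r, ENNReal.ofReal ρ *
      ∫⁻ θ in Set.Ioo (-Real.pi) Real.pi, f (circleMap c ρ θ) := by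
  have h1 : ∫⁻ z in ball c r, f z = ∫⁻ z, (ball (0 : ℂ) r).indicator (fun z => f (c + z)) z := by
    rw [← lintegral_indicator measurableSet_ball, ← lintegral_add_left_eq_self _ c]
    refine lintegral_congr fun z => ?_
    simp [Set.indicator, dist_eq_norm]
  rw [h1, ← Complex.lintegral_comp_polarCoord_symm]
  have h2 : ∀ p ∈ polarCoord.target, ENNReal.ofReal p.1 •
      (ball (0 : ℂ) r).indicator (fun z => f (c + z)) (Complex.polarCoord.symm p)
      = ENNReal.ofReal p.1 * (if p.1 < r then f (circleMap c p.1 p.2) else 0) := by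
    rintro ⟨ρ, θ⟩ hp
    have hρ : 0 < ρ := by simpa using hp.1
    simp only [Set.indicator, mem_ball_zero_iff, Complex.norm_polarCoord_symm, abs_of_pos hρ,
      smul_eq_mul]
    rw [Complex.polarCoord_symm_apply, circleMap, Complex.exp_mul_I, Complex.ofReal_cos,
      Complex.ofReal_sin]
  rw [setLIntegral_congr_fun polarCoord.open_target.measurableSet h2, polarCoord_target,
    Measure.volume_eq_prod, setLIntegral_prod]
  · rw [← lintegral_indicator measurableSet_Ioi, ← lintegral_indicator measurableSet_Ioo]
    refine lintegral_congr fun ρ => ?_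
    by_cases h0 : 0 < ρ <;> by_cases hr : ρ < r <;> simp [h0, hr]
    rw [lintegral_const_mul]
    exact hf.comp (continuous_circleMap c ρ).measurable
  · refine Measurable.aemeasurable (.mul (by fun_prop) (.ite ?_ (hf.comp ?_) measurable_const))
    · exact measurableSet_lt measurable_fst measurable_const
    · simp only [circleMap]; fun_prop

lemma intervalIntegral_circleMap_of_differentiableOn {g : ℂ → ℂ} {c : ℂ} {r ρ : ℝ}
    (hg : DifferentiableOn ℂ g (ball c r)) (h0 : 0 ≤ ρ) (hρ : ρ < r) :
    ∫ θ in (-Real.pi)..Real.pi, g (circleMap c ρ θ) = (2 * Real.pi : ℝ) * g c := by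
  have hd : DiffContOnCl ℂ g (ball c |ρ|) := by
    refine (hg.mono ?_).diffContOnCl
    rw [abs_of_nonneg h0]
    exact closure_ball_subset_closedBall.trans (closedBall_subset_ball hρ)
  have hp : Function.Periodic (fun θ => g (circleMap c ρ θ)) (2 * Real.pi) := fun θ => by
    simp [periodic_circleMap c ρ θ]
  have := hp.intervalIntegral_add_eq (-Real.pi) 0
  rw [show -Real.pi + 2 * Real.pi = Real.pi by ring, zero_add] at this
  rw [this, ← hd.circleAverage, Real.circleAverage, Complex.real_smul, ← mul_assoc,
    ← Complex.ofReal_mul, mul_inv_cancel₀ (by positivity), Complex.ofReal_one, one_mul]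

lemma continuous_comp_circleMap {g : ℂ → ℂ} {c : ℂ} {r ρ : ℝ}
    (hg : DifferentiableOn ℂ g (ball c r)) (h0 : 0 ≤ ρ) (hρ : ρ < r) :
    Continuous fun θ => g (circleMap c ρ θ) :=
  hg.continuousOn.comp_continuous (continuous_circleMap c ρ) fun θ =>
    closedBall_subset_ball hρ (circleMap_mem_closedBall c h0 θ)

lemma lintegral_ofReal_re_circleMap {g : ℂ → ℂ} {c : ℂ} {r ρ : ℝ}
    (hg : DifferentiableOn ℂ g (ball c r)) (hpos : ∀ z ∈ ball c r, 0 ≤ (g z).re)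
    (h0 : 0 ≤ ρ) (hρ : ρ < r) :
    ∫⁻ θ in Set.Ioo (-Real.pi) Real.pi, ENNReal.ofReal (g (circleMap c ρ θ)).re
      = ENNReal.ofReal (2 * Real.pi * (g c).re) := by
  have hc := continuous_comp_circleMap hg h0 hρ
  have hi : Integrable (fun θ => g (circleMap c ρ θ))
      (volume.restrict (Set.Ioo (-Real.pi) Real.pi)) :=
    (hc.integrableOn_Icc (a := -Real.pi) (b := Real.pi)).mono_set Set.Ioo_subset_Icc_self
  have hire : Integrable (fun θ => (g (circleMap c ρ θ)).re)
      (volume.restrict (Set.Ioo (-Real.pi) Real.pi)) := hi.re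
  rw [← ofReal_integral_eq_lintegral_ofReal hire (Filter.Eventually.of_forall fun θ =>
    hpos _ (closedBall_subset_ball hρ (circleMap_mem_closedBall c h0 θ)))]
  congr 1
  have h1 := intervalIntegral_circleMap_of_differentiableOn hg h0 hρ
  rw [intervalIntegral.integral_of_le (by linarith [Real.pi_pos]), integral_Ioc_eq_integral_Ioo]
    at h1
  have h2 := integral_re hi
  simp only [RCLike.re_eq_complex_re] at h2
  erw [h2, h1, Complex.re_ofReal_mul]

lemma measurable_indicator_of_continuousOn {f : ℂ → ENNReal} {s : Set ℂ} (hs : MeasurableSet s)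
    (hf : ContinuousOn f s) : Measurable (s.indicator f) := by
  classical
  rw [← Set.piecewise_eq_indicator]
  exact hf.measurable_piecewise continuousOn_const hs

lemma measurable_indicator_enorm_sq {G : ℂ → ℂ} {s : Set ℂ} (hs : MeasurableSet s)
    (hG : ContinuousOn G s) : Measurable (s.indicator fun z => ‖G z‖ₑ ^ 2) :=
  measurable_indicator_of_continuousOn hs ((ENNReal.continuous_pow 2).comp_continuousOn hG.enorm)

/-- The area mean value inequality for the square of the modulus of a holomorphic function. -/
lemma enorm_sq_le_lintegral_ball {G : ℂ → ℂ} {c : ℂ} {r : ℝ} (hr : 0 < r)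
    (hG : DifferentiableOn ℂ G (ball c r)) :
    ENNReal.ofReal (Real.pi * r ^ 2) * ‖G c‖ₑ ^ 2 ≤ ∫⁻ z in ball c r, ‖G z‖ₑ ^ 2 := by
  rw [← lintegral_indicator measurableSet_ball, ← setLIntegral_eq_of_support_subset
    (s := ball c r) (Set.support_indicator_subset), lintegral_ball_eq_polar _
    (measurable_indicator_enorm_sq measurableSet_ball hG.continuousOn)]
  have key : ∀ ρ ∈ Set.Ioo 0 r, ENNReal.ofReal ρ * (ENNReal.ofReal (2 * Real.pi) * ‖G c‖ₑ ^ 2) ≤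
      ENNReal.ofReal ρ * ∫⁻ θ in Set.Ioo (-Real.pi) Real.pi,
        (ball c r).indicator (fun z => ‖G z‖ₑ ^ 2) (circleMap c ρ θ) := by
    rintro ρ ⟨h0, hρ⟩
    gcongr
    have h1 := intervalIntegral_circleMap_of_differentiableOn (hG.pow 2) h0.le hρ
    rw [intervalIntegral.integral_of_le (by linarith [Real.pi_pos]),
      integral_Ioc_eq_integral_Ioo] at h1
    have h2 := enorm_integral_le_lintegral_enorm (μ := volume.restrict
      (Set.Ioo (-Real.pi) Real.pi)) fun θ => (G ^ 2) (circleMap c ρ θ)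
    rw [h1, enorm_mul, ← ofReal_norm, Complex.norm_real, Real.norm_of_nonneg (by positivity)] at h2
    simp only [Pi.pow_apply, enorm_pow] at h2
    refine h2.trans_eq (lintegral_congr fun θ => ?_)
    rw [Set.indicator_of_mem
      (closedBall_subset_ball hρ (circleMap_mem_closedBall c h0.le θ))]
  refine le_trans (le_of_eq ?_) (setLIntegral_mono' measurableSet_Ioo key)
  rw [lintegral_mul_const _ (by fun_prop), ← mul_assoc]
  congr 1
  rw [← ofReal_integral_eq_lintegral_ofReal, ← ENNReal.ofReal_mul, ← integral_Ioc_eq_integral_Ioo,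
    ← intervalIntegral.integral_of_le hr.le, integral_id]
  · congr 1; ring
  · rw [← integral_Ioc_eq_integral_Ioo, ← intervalIntegral.integral_of_le hr.le, integral_id]
    nlinarith
  · exact (continuous_id.integrableOn_Icc (a := 0) (b := r)).mono_set Set.Ioo_subset_Icc_self
  · exact (ae_restrict_iff' measurableSet_Ioo).2 (Filter.Eventually.of_forall fun x hx => hx.1.le)

/-- A positive harmonic function `Re g` on the right half-plane which is `O(1/T)` at the real
point `T` has uniformly bounded mass on vertical strips. -/
lemma lintegral_re_div_sq_le {g : ℂ → ℂ} (hg : DifferentiableOn ℂ g rightHalfPlane)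
    (hpos : ∀ z ∈ rightHalfPlane, 0 ≤ (g z).re) {l d : ℝ} (hd : 0 < d)
    (hT : ∀ T : ℝ, 0 < T → (g T).re ≤ l / T) :
    ∫⁻ z in rightHalfPlane, ENNReal.ofReal ((g z).re / (d + z.re) ^ 2)
      ≤ ENNReal.ofReal (2 * Real.pi * l / d) := by
  have hsub : ∀ T : ℝ, ball (T : ℂ) T ⊆ rightHalfPlane := fun T z hz => by
    have h1 := (abs_re_le_norm (z - T)).trans_lt (mem_ball_iff_norm.1 hz)
    have h2 := (abs_lt.1 h1).1
    simp only [sub_re, ofReal_re] at h2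
    show 0 < z.re
    linarith
  have hball : ∀ T : ℝ, 0 < T → ∫⁻ z in ball (T : ℂ) T,
      ENNReal.ofReal ((g z).re / (d + z.re) ^ 2) ≤ ENNReal.ofReal (2 * Real.pi * l / d) := by
    intro T hT0
    have hgT := hg.mono (hsub T)
    have hm : Measurable ((ball (T : ℂ) T).indicator
        fun z => ENNReal.ofReal ((g z).re / (d + T - ‖z - T‖) ^ 2)) := by
      refine measurable_indicator_of_continuousOn measurableSet_ball
        (ENNReal.continuous_ofReal.comp_continuousOn ?_)
      refine (continuous_re.comp_continuousOn hgT.continuousOn).div (by fun_prop) fun z hz => ?_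
      have := mem_ball_iff_norm.1 hz
      have : 0 < d + T - ‖z - T‖ := by linarith
      positivity
    have h1 : ∫⁻ z in ball (T : ℂ) T, ENNReal.ofReal ((g z).re / (d + z.re) ^ 2) ≤
        ∫⁻ z in ball (T : ℂ) T, (ball (T : ℂ) T).indicator
          (fun z => ENNReal.ofReal ((g z).re / (d + T - ‖z - T‖) ^ 2)) z := by
      refine setLIntegral_mono' measurableSet_ball fun z hz => ?_
      rw [Set.indicator_of_mem hz]
      have h2 := mem_ball_iff_norm.1 hz
      have h3 := neg_le_of_abs_le (abs_re_le_norm (z - T))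
      simp only [sub_re, ofReal_re] at h3
      have h4 : 0 < d + T - ‖z - T‖ := by linarith
      have := hpos z (hsub T hz)
      gcongr
      linarith
    refine h1.trans ?_
    rw [lintegral_ball_eq_polar _ hm]
    have h5 : ∀ ρ ∈ Set.Ioo 0 T, ENNReal.ofReal ρ * ∫⁻ θ in Set.Ioo (-Real.pi) Real.pi,
        (ball (T : ℂ) T).indicator (fun z => ENNReal.ofReal ((g z).re / (d + T - ‖z - T‖) ^ 2))
          (circleMap T ρ θ) ≤ ENNReal.ofReal (2 * Real.pi * l * ((d + T - ρ) ^ 2)⁻¹) := by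
      rintro ρ ⟨h0, hρ⟩
      have h6 : ∀ θ : ℝ, (ball (T : ℂ) T).indicator
          (fun z => ENNReal.ofReal ((g z).re / (d + T - ‖z - T‖) ^ 2)) (circleMap T ρ θ)
          = ENNReal.ofReal ((d + T - ρ) ^ 2)⁻¹ * ENNReal.ofReal (g (circleMap T ρ θ)).re := by
        intro θ
        rw [Set.indicator_of_mem
          (closedBall_subset_ball hρ (circleMap_mem_closedBall _ h0.le θ)),
          ← ENNReal.ofReal_mul (by positivity), circleMap_sub_center, norm_circleMap_zero,
          abs_of_pos h0]
        congr 1; ring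
      simp only [h6]
      rw [lintegral_const_mul' _ _ ENNReal.ofReal_ne_top,
        lintegral_ofReal_re_circleMap hgT (fun z hz => hpos z (hsub T hz)) h0.le hρ,
        ← ENNReal.ofReal_mul (by positivity), ← ENNReal.ofReal_mul h0.le]
      refine ENNReal.ofReal_le_ofReal ?_
      have h7 : ρ * (g T).re ≤ l := by
        have := hT T hT0
        rw [le_div_iff₀ hT0] at this
        have := hpos T (by simpa using hT0)
        nlinarith
      calc _ = (ρ * (g T).re) * (2 * Real.pi * ((d + T - ρ) ^ 2)⁻¹) := by ring
        _ ≤ l * (2 * Real.pi * ((d + T - ρ) ^ 2)⁻¹) := by gcongr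
        _ = _ := by ring
    refine (setLIntegral_mono' measurableSet_Ioo h5).trans ?_
    have hl : 0 ≤ l := by
      have h8 := (hpos T (by simpa using hT0)).trans (hT T hT0)
      rw [le_div_iff₀ hT0] at h8
      linarith
    have hder : ∀ x ∈ Set.uIcc 0 T,
        HasDerivAt (fun ρ => (d + T - ρ)⁻¹) (((d + T - x) ^ 2)⁻¹) x := by
      intro x hx
      rw [Set.uIcc_of_le hT0.le] at hx
      have : d + T - x ≠ 0 := by linarith [hx.2]
      have := ((hasDerivAt_id x).const_sub (d + T)).fun_inv this
      simpa [div_eq_mul_inv] using this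
    have hcont : ContinuousOn (fun x => ((d + T - x) ^ 2)⁻¹) (Set.Icc 0 T) := by
      refine ContinuousOn.inv₀ (by fun_prop) fun x hx => ?_
      have : 0 < d + T - x := by linarith [hx.2]
      positivity
    have hint := intervalIntegral.integral_eq_sub_of_hasDerivAt hder
      (by rw [← Set.uIcc_of_le hT0.le] at hcont; exact hcont.intervalIntegrable)
    rw [← ofReal_integral_eq_lintegral_ofReal, integral_const_mul, ← integral_Ioc_eq_integral_Ioo,
      ← intervalIntegral.integral_of_le hT0.le, hint]
    · refine ENNReal.ofReal_le_ofReal ?_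
      have : 0 < (d + T)⁻¹ := by positivity
      rw [div_eq_mul_inv]
      gcongr
      simp only [add_sub_cancel_right, sub_zero]
      linarith
    · exact ((hcont.integrableOn_Icc).mono_set Set.Ioo_subset_Icc_self).const_mul _
    · exact Filter.Eventually.of_forall fun x => by positivity
  have hmono : Monotone fun n : ℕ => ball ((n : ℝ) : ℂ) n := by
    intro m n hmn
    refine ball_subset_ball' ?_
    have : (m : ℝ) ≤ n := by exact_mod_cast hmn
    rw [dist_eq_norm, ← ofReal_sub, norm_real, Real.norm_of_nonpos (by linarith)]
    linarith
  have hun : rightHalfPlane ⊆ ⋃ n : ℕ, ball ((n : ℝ) : ℂ) n := by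
    intro z hz
    have hz : 0 < z.re := hz
    obtain ⟨n, hn⟩ := exists_nat_gt (‖z‖ ^ 2 / (2 * z.re))
    rw [div_lt_iff₀ (by positivity)] at hn
    refine Set.mem_iUnion.2 ⟨n, ?_⟩
    rw [mem_ball_iff_norm]
    refine lt_of_pow_lt_pow_left₀ 2 (by positivity) ?_
    rw [Complex.sq_norm, normSq_apply] at hn ⊢
    simp only [sub_re, sub_im, ofReal_re, ofReal_im]
    nlinarith
  refine (lintegral_mono_set hun).trans ?_
  rw [setLIntegral_iUnion_of_directed _ hmono.directed_le]
  refine iSup_le fun n => ?_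
  rcases Nat.eq_zero_or_pos n with rfl | hn
  · simp
  · exact hball n (by exact_mod_cast hn)

/-! ### The Bergman norm and the reproducing kernels -/

lemma hpBergNorm_nonneg (F : ℂ → ℂ) : 0 ≤ hpBergNorm F := Real.sqrt_nonneg _

lemma hpBergNorm_sq (F : ℂ → ℂ) : hpBergNorm F ^ 2 = ∫ s in rightHalfPlane, ‖F s‖ ^ 2 :=
  Real.sq_sqrt (integral_nonneg fun _ => by positivity)

lemma lintegral_enorm_sq_eq {F : ℂ → ℂ} (hF : MemA2Plane F) :
    ∫⁻ s in rightHalfPlane, ‖F s‖ₑ ^ 2 = ENNReal.ofReal (hpBergNorm F ^ 2) := by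
  rw [hpBergNorm_sq, ofReal_integral_eq_lintegral_ofReal hF.2
    (Filter.Eventually.of_forall fun _ => by positivity)]
  refine lintegral_congr fun s => ?_
  rw [ENNReal.ofReal_pow (norm_nonneg _), ofReal_norm]

/-- The unnormalized reproducing kernel at `w`. -/
def hpKernel (w s : ℂ) : ℂ := ((s + (starRingEnd ℂ) w) ^ 2)⁻¹

lemma add_conj_ne_zero {w s : ℂ} (hw : 0 < w.re) (hs : 0 < s.re) :
    s + (starRingEnd ℂ) w ≠ 0 := fun h => by
  have := congrArg Complex.re h
  simp only [add_re, conj_re, zero_re] at this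
  linarith

lemma differentiableOn_hpKernel {w : ℂ} (hw : 0 < w.re) :
    DifferentiableOn ℂ (hpKernel w) rightHalfPlane :=
  DifferentiableOn.inv (by fun_prop) fun _ hs => pow_ne_zero 2 (add_conj_ne_zero hw hs)

lemma norm_hpKernel_sq (w s : ℂ) :
    ‖hpKernel w s‖ ^ 2 = (‖s + (starRingEnd ℂ) w‖ ^ 4)⁻¹ := by
  rw [hpKernel, norm_inv, norm_pow, inv_pow, ← pow_mul]

lemma integrableOn_hpKernel_one :
    IntegrableOn (fun s => ‖hpKernel 1 s‖ ^ 2) rightHalfPlane := by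
  have h := (integrable_rpow_neg_one_add_norm_sq (E := ℂ) (μ := volume) (r := 4)
    (by rw [Complex.finrank_real_complex]; norm_num)).integrableOn (s := rightHalfPlane)
  refine h.mono' ?_ ?_
  · exact ((differentiableOn_hpKernel (by simp)).continuousOn.norm.pow 2).aestronglyMeasurable
      isOpen_rightHalfPlane.measurableSet
  · refine (ae_restrict_iff' isOpen_rightHalfPlane.measurableSet).2
      (Filter.Eventually.of_forall fun s hs => ?_)
    have hs : 0 < s.re := hs
    rw [Real.norm_of_nonneg (by positivity), norm_hpKernel_sq,
      show (-4 / 2 : ℝ) = ((-2 : ℤ) : ℝ) by norm_num, Real.rpow_intCast, zpow_neg]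
    gcongr
    have h1 : 1 + ‖s‖ ^ 2 ≤ ‖s + (starRingEnd ℂ) 1‖ ^ 2 := by
      rw [Complex.sq_norm, Complex.sq_norm, normSq_apply, normSq_apply]
      simp
      nlinarith
    calc (1 + ‖s‖ ^ 2) ^ (2 : ℤ) = (1 + ‖s‖ ^ 2) ^ 2 := by norm_cast
      _ ≤ (‖s + (starRingEnd ℂ) 1‖ ^ 2) ^ 2 := by gcongr
      _ = _ := by ring

lemma indicator_hpKernel_smul_add {w : ℂ} (hw : 0 < w.re) (v : ℂ) :
    rightHalfPlane.indicator (fun s => ‖hpKernel w s‖ ^ 2) (w.re • v + w.im * I)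
      = (w.re ^ 4)⁻¹ * rightHalfPlane.indicator (fun s => ‖hpKernel 1 s‖ ^ 2) v := by
  have h1 : w.re • v + w.im * I ∈ rightHalfPlane ↔ v ∈ rightHalfPlane := by
    simp [rightHalfPlane, hw]
  by_cases hv : v ∈ rightHalfPlane
  · rw [Set.indicator_of_mem hv, Set.indicator_of_mem (h1.2 hv), norm_hpKernel_sq,
      norm_hpKernel_sq]
    have : w.re • v + w.im * I + (starRingEnd ℂ) w = w.re * (v + (starRingEnd ℂ) 1) := by
      apply Complex.ext <;> simp; ring
    rw [this, norm_mul, norm_real, Real.norm_of_nonneg hw.le, mul_pow, mul_inv]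
  · rw [Set.indicator_of_notMem hv, Set.indicator_of_notMem (mt h1.1 hv), mul_zero]

lemma memA2Plane_hpKernel {w : ℂ} (hw : 0 < w.re) : MemA2Plane (hpKernel w) := by
  refine ⟨differentiableOn_hpKernel hw, ?_⟩
  have h1 := (integrable_indicator_iff isOpen_rightHalfPlane.measurableSet).2
    integrableOn_hpKernel_one
  have h2 := h1.const_mul (w.re ^ 4)⁻¹
  simp only [← indicator_hpKernel_smul_add hw] at h2
  have h3 := (integrable_comp_smul_iff volume (fun v : ℂ => rightHalfPlane.indicator
    (fun s => ‖hpKernel w s‖ ^ 2) (v + w.im * I)) hw.ne').1 h2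
  have h4 := h3.comp_add_right (-(w.im * I))
  simp only [neg_add_cancel_right] at h4
  exact (integrable_indicator_iff isOpen_rightHalfPlane.measurableSet).1 h4

lemma hpBergNorm_hpKernel_sq {w : ℂ} (hw : 0 < w.re) :
    hpBergNorm (hpKernel w) ^ 2 = hpBergNorm (hpKernel 1) ^ 2 / w.re ^ 2 := by
  rw [hpBergNorm_sq, hpBergNorm_sq, ← integral_indicator isOpen_rightHalfPlane.measurableSet,
    ← integral_indicator isOpen_rightHalfPlane.measurableSet,
    ← integral_add_right_eq_self _ ((w.im : ℂ) * I)]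
  have h := Measure.integral_comp_smul volume (fun v : ℂ => rightHalfPlane.indicator
    (fun s => ‖hpKernel w s‖ ^ 2) (v + w.im * I)) w.re
  simp only [indicator_hpKernel_smul_add hw] at h
  rw [integral_const_mul, Complex.finrank_real_complex, abs_of_pos (by positivity),
    smul_eq_mul] at h
  field_simp at h ⊢
  linarith

lemma hpBergNorm_hpKernel_one_pos : 0 < hpBergNorm (hpKernel 1) := by
  refine Real.sqrt_pos.2 ?_
  rw [setIntegral_pos_iff_support_of_nonneg_ae (Filter.Eventually.of_forall fun _ => by positivity)
    integrableOn_hpKernel_one]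
  refine lt_of_lt_of_le (isOpen_rightHalfPlane.measure_pos volume ⟨1, by simp [rightHalfPlane]⟩)
    (measure_mono fun s hs => ⟨?_, hs⟩)
  have : hpKernel 1 s ≠ 0 := inv_ne_zero (pow_ne_zero 2 (add_conj_ne_zero (by simp) hs))
  simpa using this

lemma hpBergNorm_hpKernel_pos {w : ℂ} (hw : 0 < w.re) : 0 < hpBergNorm (hpKernel w) := by
  refine lt_of_le_of_ne (hpBergNorm_nonneg _) fun h => ?_
  have h1 := hpBergNorm_hpKernel_sq hw
  rw [← h] at h1
  have := hpBergNorm_hpKernel_one_pos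
  have : 0 < hpBergNorm (hpKernel 1) ^ 2 / w.re ^ 2 := by positivity
  linarith [h1, zero_pow (M₀ := ℝ) two_ne_zero]

lemma bergKtildePlane_eq (w s : ℂ) :
    bergKtildePlane w s = ((hpBergNorm (hpKernel w))⁻¹ : ℝ) * hpKernel w s := by
  simp only [bergKtildePlane, div_eq_mul_inv, mul_comm, ofReal_inv]
  rfl

lemma hpBergNorm_const_mul (c : ℝ) (F : ℂ → ℂ) :
    hpBergNorm (fun s => (c : ℂ) * F s) = |c| * hpBergNorm F := by
  simp only [hpBergNorm, norm_mul, mul_pow, integral_const_mul, norm_real, Real.norm_eq_abs, sq_abs]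
  rw [Real.sqrt_mul (sq_nonneg c), Real.sqrt_sq_eq_abs]

lemma MemA2Plane.const_mul {F : ℂ → ℂ} (hF : MemA2Plane F) (c : ℂ) :
    MemA2Plane fun s => c * F s := by
  refine ⟨hF.1.const_mul c, ?_⟩
  simp only [norm_mul, mul_pow]
  exact hF.2.const_mul _

/-- A bounded composition operator on `A²(ℂ₊)` has a symbol with finite angular derivative
at infinity. -/
lemma exists_re_le_mul_re {Φ : ℂ → ℂ} (hΦm : Set.MapsTo Φ rightHalfPlane rightHalfPlane)
    {M : ℝ} (hM : 0 < M) (hbdd : ∀ F : ℂ → ℂ, MemA2Plane F → MemA2Plane (fun s => F (Φ s)) ∧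
      hpBergNorm (fun s => F (Φ s)) ≤ M * hpBergNorm F) :
    ∃ l > 0, ∀ z ∈ rightHalfPlane, z.re ≤ l * (Φ z).re := by
  set κ := hpBergNorm (hpKernel 1)
  have hκ : 0 < κ := hpBergNorm_hpKernel_one_pos
  refine ⟨4 * M * κ, by positivity, fun z hz => ?_⟩
  have hz : 0 < z.re := hz
  have hw : 0 < (Φ z).re := hΦm hz
  obtain ⟨h1, h2⟩ := hbdd _ (memA2Plane_hpKernel hw)
  have hsub : ball z z.re ⊆ rightHalfPlane := fun s hs => by
    have h1 := (abs_re_le_norm (s - z)).trans_lt (mem_ball_iff_norm.1 hs)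
    have h2 := (abs_lt.1 h1).1
    simp only [sub_re] at h2
    show 0 < s.re
    linarith
  have h3 := (enorm_sq_le_lintegral_ball hz (h1.1.mono hsub)).trans
    ((lintegral_mono_set hsub).trans_eq (lintegral_enorm_sq_eq h1))
  rw [← ofReal_norm, ← ENNReal.ofReal_pow (norm_nonneg _), ← ENNReal.ofReal_mul (by positivity),
    ENNReal.ofReal_le_ofReal_iff (by positivity), norm_hpKernel_sq, add_conj, norm_real,
    Real.norm_of_nonneg (by positivity)] at h3
  have h4 := pow_le_pow_left₀ (hpBergNorm_nonneg _) h2 2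
  rw [mul_pow, hpBergNorm_hpKernel_sq hw] at h4
  have h5 : z.re ^ 2 ≤ (4 * M * κ * (Φ z).re) ^ 2 := by
    have h6 := h3.trans h4
    rw [mul_inv_le_iff₀ (by positivity)] at h6
    have h7 : M ^ 2 * (κ ^ 2 / (Φ z).re ^ 2) * (2 * (Φ z).re) ^ 4
        = (4 * M * κ * (Φ z).re) ^ 2 := by field_simp; ring
    change _ ≤ M ^ 2 * (κ ^ 2 / (Φ z).re ^ 2) * (2 * (Φ z).re) ^ 4 at h6
    rw [h7] at h6
    nlinarith [Real.pi_gt_three, sq_nonneg z.re]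
  exact le_of_sq_le_sq h5 (by positivity)

/-! ### Values of the symbol near a prescribed point -/

/-- The Schwarz–Pick lemma for the right half-plane. -/
lemma norm_sub_mul_norm_add_conj_le {Φ : ℂ → ℂ} (hΦd : DifferentiableOn ℂ Φ rightHalfPlane)
    (hΦm : Set.MapsTo Φ rightHalfPlane rightHalfPlane) {z z₀ : ℂ} (hz : z ∈ rightHalfPlane)
    (hz₀ : z₀ ∈ rightHalfPlane) :
    ‖Φ z - Φ z₀‖ * ‖z + (starRingEnd ℂ) z₀‖ ≤ ‖z - z₀‖ * ‖Φ z + (starRingEnd ℂ) (Φ z₀)‖ := by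
  have hz' : 0 < z.re := hz
  have hz₀' : 0 < z₀.re := hz₀
  have hlt : ∀ p q : ℂ, 0 < p.re → 0 < q.re → ‖p - q‖ < ‖p + (starRingEnd ℂ) q‖ := by
    intro p q hp hq
    refine lt_of_pow_lt_pow_left₀ 2 (norm_nonneg _) ?_
    rw [Complex.sq_norm, Complex.sq_norm, normSq_apply, normSq_apply]
    simp only [sub_re, sub_im, add_re, add_im, conj_re, conj_im]
    nlinarith [mul_pos hp hq]
  set m : ℂ → ℂ := fun u => z₀.re * ((1 + u) / (1 - u)) + z₀.im * I
  have hne : ∀ u ∈ ball (0 : ℂ) 1, 1 - u ≠ 0 := by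
    intro u hu h
    rw [mem_ball_zero_iff, ← sub_eq_zero.1 h, norm_one] at hu
    exact lt_irrefl _ hu
  have hm : Set.MapsTo m (ball 0 1) rightHalfPlane := by
    intro u hu
    have h1 : normSq u < 1 := by
      rw [mem_ball_zero_iff] at hu
      rw [← Complex.sq_norm]
      nlinarith [norm_nonneg u]
    have h2 : 0 < normSq (1 - u) := normSq_pos.2 (hne u hu)
    have h3 : ((1 + u) / (1 - u)).re = (1 - normSq u) / normSq (1 - u) := by
      rw [div_re, ← add_div]
      congr 1
      simp [normSq_apply]
      ring
    show 0 < (m u).re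
    simp only [m, add_re, re_ofReal_mul, mul_I_re, ofReal_im, neg_zero, add_zero, h3]
    have : 0 < 1 - normSq u := by linarith
    positivity
  have hmd : DifferentiableOn ℂ m (ball 0 1) := by
    refine DifferentiableOn.add (.const_mul (.div (by fun_prop) (by fun_prop) hne) _) (by fun_prop)
  set f : ℂ → ℂ := fun u => (Φ (m u) - Φ z₀) / (Φ (m u) + (starRingEnd ℂ) (Φ z₀))
  have hfd : DifferentiableOn ℂ f (ball 0 1) := by
    have h1 := hΦd.comp hmd hm
    exact (h1.sub_const _).div (h1.add_const _) fun u hu =>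
      add_conj_ne_zero (hΦm hz₀) (hΦm (hm hu))
  have hf : Set.MapsTo f (ball 0 1) (ball 0 1) := by
    intro u hu
    have h1 := hlt (Φ (m u)) (Φ z₀) (hΦm (hm hu)) (hΦm hz₀)
    rw [mem_ball_zero_iff, norm_div, div_lt_one ((norm_nonneg _).trans_lt h1)]
    exact h1
  have hm0 : m 0 = z₀ := by simp [m, re_add_im]
  set u : ℂ := (z - z₀) / (z + (starRingEnd ℂ) z₀)
  have hd := add_conj_ne_zero hz₀' hz'
  have hu : ‖u‖ < 1 := by
    rw [norm_div, div_lt_one (norm_pos_iff.2 hd)]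
    exact hlt z z₀ hz' hz₀'
  have hmu : m u = z := by
    have h1 : 1 - u ≠ 0 := hne u (mem_ball_zero_iff.2 hu)
    have h2 : (1 + u) * (z + (starRingEnd ℂ) z₀) = 2 * z - 2 * (z₀.im * I) := by
      have : u * (z + (starRingEnd ℂ) z₀) = z - z₀ := div_mul_cancel₀ _ hd
      rw [add_mul, this]
      apply Complex.ext <;> simp <;> ring
    have h3 : (1 - u) * (z + (starRingEnd ℂ) z₀) = 2 * z₀.re := by
      have : u * (z + (starRingEnd ℂ) z₀) = z - z₀ := div_mul_cancel₀ _ hd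
      rw [sub_mul, this]
      apply Complex.ext <;> simp
      ring
    have h4 : (z₀.re : ℂ) ≠ 0 := by exact_mod_cast hz₀'.ne'
    simp only [m]
    rw [← mul_div_mul_right (1 + u) (1 - u) hd, h2, h3]
    field_simp
    ring
  have key := norm_le_norm_of_mapsTo_ball hfd (hf.mono_right ball_subset_closedBall)
    (by simp [f, hm0]) hu
  simp only [f, hmu, u, norm_div] at key
  rwa [div_le_div_iff₀ (norm_pos_iff.2 (add_conj_ne_zero (hΦm hz₀) (hΦm hz)))
    (norm_pos_iff.2 hd)] at key

/-- If the image of the kernel at `w` is not small, then `Φ` takes a value comparable to `w`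
at a point whose distance to the boundary is at least comparable to that of `w`. -/
lemma exists_re_ge_and_norm_le {Φ : ℂ → ℂ} (hΦd : DifferentiableOn ℂ Φ rightHalfPlane)
    (hΦm : Set.MapsTo Φ rightHalfPlane rightHalfPlane) {l : ℝ} (hl : 0 < l)
    (hΦl : ∀ z ∈ rightHalfPlane, z.re ≤ l * (Φ z).re) {C : ℝ} (hC : 0 < C) :
    ∃ η > 0, ∃ R ≥ 1, ∀ w ∈ rightHalfPlane,
      ENNReal.ofReal C ≤ ∫⁻ z in rightHalfPlane,
        ENNReal.ofReal (w.re ^ 2 / ‖Φ z + (starRingEnd ℂ) w‖ ^ 4) →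
      ∃ z₀ ∈ rightHalfPlane, η * w.re ≤ z₀.re ∧ ‖Φ z₀ + (starRingEnd ℂ) w‖ ≤ R * w.re := by
  set η : ℝ := C / (32 * Real.pi * l) with hη
  set R : ℝ := 1 + 8 * Real.pi * l ^ 2 / C with hR
  have hη0 : 0 < η := by positivity
  have hR0 : 1 ≤ R := le_add_of_nonneg_right (by positivity)
  refine ⟨η, hη0, R, hR0, fun w hw hint => ?_⟩
  by_contra! hcon
  have ha : 0 < w.re := hw
  set a := w.re
  have hre : ∀ z, (Φ z + (starRingEnd ℂ) w).re = (Φ z).re + a := fun z => by simp [a]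
  have hne : ∀ z ∈ rightHalfPlane, Φ z + (starRingEnd ℂ) w ≠ 0 := fun z hz =>
    add_conj_ne_zero hw (hΦm hz)
  set g : ℂ → ℂ := fun z => (Φ z + (starRingEnd ℂ) w)⁻¹
  have hg : DifferentiableOn ℂ g rightHalfPlane := (hΦd.add_const _).inv hne
  have hgre : ∀ z, (g z).re = ((Φ z).re + a) / ‖Φ z + (starRingEnd ℂ) w‖ ^ 2 := fun z => by
    simp only [g, inv_re, hre, Complex.sq_norm]
  have hgpos : ∀ z ∈ rightHalfPlane, 0 ≤ (g z).re := fun z hz => by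
    have : 0 < (Φ z).re := hΦm hz
    rw [hgre]; positivity
  have hgT : ∀ T : ℝ, 0 < T → (g T).re ≤ l / T := by
    intro T hT
    have hT' : (T : ℂ) ∈ rightHalfPlane := by simpa using hT
    have h0 : 0 < (Φ T).re := hΦm hT'
    have h1 := hΦl T hT'
    rw [ofReal_re] at h1
    have h2 : (Φ T).re ≤ ‖Φ T + (starRingEnd ℂ) w‖ :=
      le_trans (by rw [hre]; linarith) (re_le_norm _)
    refine (re_le_norm _).trans ?_
    simp only [g, norm_inv]
    rw [inv_eq_one_div, div_le_div_iff₀ (by linarith) hT]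
    nlinarith
  have hstrip := fun d (hd : 0 < d) => lintegral_re_div_sq_le hg hgpos hd hgT
  have hpt : ∀ z ∈ rightHalfPlane, ENNReal.ofReal (a ^ 2 / ‖Φ z + (starRingEnd ℂ) w‖ ^ 4) ≤
      ENNReal.ofReal (4 * η ^ 2 * a) * ENNReal.ofReal ((g z).re / (η * a + z.re) ^ 2) +
      ENNReal.ofReal (a * l ^ 2 / R) * ENNReal.ofReal ((g z).re / (l * a + z.re) ^ 2) := by
    intro z hz
    have hx : 0 < z.re := hz
    have hP : 0 < (Φ z).re := hΦm hz
    have hg0 := hgpos z hz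
    have hNP : (Φ z).re + a ≤ ‖Φ z + (starRingEnd ℂ) w‖ := by
      rw [← hre]; exact re_le_norm _
    set N := ‖Φ z + (starRingEnd ℂ) w‖ with hN
    have hN0 : 0 < N := by linarith
    have hxl := hΦl z hz
    rw [← ENNReal.ofReal_mul (by positivity), ← ENNReal.ofReal_mul (by positivity),
      ← ENNReal.ofReal_add (by positivity) (by positivity)]
    refine ENNReal.ofReal_le_ofReal ?_
    rw [hgre, ← hN]
    set P := (Φ z).re + a with hPdef
    have hP0 : 0 < P := by linarith
    have haP : a ≤ P := by linarith
    have e0 : a ^ 2 / N ^ 4 = P / N ^ 2 * (a ^ 2 / (N ^ 2 * P)) := by field_simp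
    rcases lt_or_ge z.re (η * a) with h | h
    · refine le_trans ?_ (le_add_of_nonneg_right (by positivity))
      have e1 : 4 * η ^ 2 * a * (P / N ^ 2 / (η * a + z.re) ^ 2)
          = P / N ^ 2 * (4 * η ^ 2 * a / (η * a + z.re) ^ 2) := by ring
      rw [e0, e1]
      refine mul_le_mul_of_nonneg_left ?_ (by positivity)
      have e2 : a ^ 2 / (N ^ 2 * P) ≤ a ^ 2 / (a ^ 2 * a) := by gcongr; linarith
      have e3 : 4 * η ^ 2 * a / (η * a + η * a) ^ 2 ≤ 4 * η ^ 2 * a / (η * a + z.re) ^ 2 := by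
        gcongr
      have e4 : 4 * η ^ 2 * a / (η * a + η * a) ^ 2 = a ^ 2 / (a ^ 2 * a) := by
        field_simp; ring
      linarith
    · refine le_trans ?_ (le_add_of_nonneg_left (by positivity))
      have hNR := (hcon z hz h).le
      have e1 : a * l ^ 2 / R * (P / N ^ 2 / (l * a + z.re) ^ 2)
          = P / N ^ 2 * (a * l ^ 2 / R / (l * a + z.re) ^ 2) := by ring
      rw [e0, e1]
      refine mul_le_mul_of_nonneg_left ?_ (by positivity)
      have e2 : a ^ 2 / (N ^ 2 * P) ≤ a ^ 2 / (R * a * P * P) := by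
        gcongr
        rw [sq]
        gcongr
      have e3 : a * l ^ 2 / R / (l * P) ^ 2 ≤ a * l ^ 2 / R / (l * a + z.re) ^ 2 := by
        gcongr
        rw [hPdef]
        linarith
      have e4 : a * l ^ 2 / R / (l * P) ^ 2 = a ^ 2 / (R * a * P * P) := by
        field_simp
      linarith
  have hmeas : AEMeasurable (fun z => ENNReal.ofReal (4 * η ^ 2 * a) *
      ENNReal.ofReal ((g z).re / (η * a + z.re) ^ 2)) (volume.restrict rightHalfPlane) := by
    refine AEMeasurable.const_mul (ContinuousOn.aemeasurable ?_
      isOpen_rightHalfPlane.measurableSet) _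
    refine ENNReal.continuous_ofReal.comp_continuousOn
      ((continuous_re.comp_continuousOn hg.continuousOn).div (by fun_prop) fun z hz => ?_)
    have hx : 0 < z.re := hz
    positivity
  have htot := hint.trans (setLIntegral_mono' isOpen_rightHalfPlane.measurableSet hpt)
  rw [lintegral_add_left' hmeas, lintegral_const_mul' _ _ ENNReal.ofReal_ne_top,
    lintegral_const_mul' _ _ ENNReal.ofReal_ne_top] at htot
  have htot2 := htot.trans (add_le_add
    (mul_le_mul_right (hstrip (η * a) (by positivity)) _)
    (mul_le_mul_right (hstrip (l * a) (by positivity)) _))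
  rw [← ENNReal.ofReal_mul (by positivity), ← ENNReal.ofReal_mul (by positivity),
    ← ENNReal.ofReal_add (by positivity) (by positivity),
    ENNReal.ofReal_le_ofReal_iff (by positivity)] at htot2
  have e1 : 4 * η ^ 2 * a * (2 * Real.pi * l / (η * a)) = C / 4 := by
    rw [hη]; field_simp; ring
  have e2 : a * l ^ 2 / R * (2 * Real.pi * l / (l * a)) ≤ C / 4 := by
    have : a * l ^ 2 / R * (2 * Real.pi * l / (l * a)) = 2 * Real.pi * l ^ 2 / R := by field_simp
    rw [this, div_le_iff₀ (by linarith), hR]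
    have : C / 4 * (1 + 8 * Real.pi * l ^ 2 / C) = C / 4 + 2 * Real.pi * l ^ 2 := by
      field_simp; ring
    linarith
  linarith

/-- Along a horizontal ray, `Φ` takes values with every real part in `[R a, 2 R a]`, and small
hyperbolic discs around the corresponding points are mapped to a bounded hyperbolic
neighbourhood of `w`. -/
lemma exists_re_eq_and_mapsTo {Φ : ℂ → ℂ} (hΦd : DifferentiableOn ℂ Φ rightHalfPlane)
    (hΦm : Set.MapsTo Φ rightHalfPlane rightHalfPlane) {l : ℝ} (hl : 0 < l)
    (hΦl : ∀ z ∈ rightHalfPlane, z.re ≤ l * (Φ z).re) {η R : ℝ} (hη : 0 < η) (hR : 1 ≤ R)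
    {w z₀ : ℂ} (hw : w ∈ rightHalfPlane) (hz₀ : z₀ ∈ rightHalfPlane) (hη₀ : η * w.re ≤ z₀.re)
    (hR₀ : ‖Φ z₀ + (starRingEnd ℂ) w‖ ≤ R * w.re) {t : ℝ} (ht : t ∈ Set.Icc R (2 * R)) :
    ∃ z, (Φ z).re = t * w.re ∧ ∀ s ∈ ball z (η / 2 * w.re), s ∈ rightHalfPlane ∧
      η / (2 * l) * w.re ≤ (Φ s).re ∧ ‖Φ s - w‖ ≤ (2 * l * R ^ 2 / η + 5 * R + 2) * w.re := by
  have ha : 0 < w.re := hw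
  have hx₀ : 0 < z₀.re := hz₀
  set a := w.re
  have hΦz₀ : 0 < (Φ z₀).re := hΦm hz₀
  have hre₀ : (Φ z₀).re + a ≤ R * a := by
    have := (re_le_norm _).trans hR₀
    simpa [a] using this
  have hray : ∀ s : ℝ, 0 ≤ s → z₀ + s ∈ rightHalfPlane := fun s hs => by
    show 0 < (z₀ + s).re
    simp only [add_re, ofReal_re]
    linarith
  have hS : 0 ≤ 2 * l * R * a := by positivity
  have hcont : ContinuousOn (fun s : ℝ => (Φ (z₀ + s)).re) (Set.Icc 0 (2 * l * R * a)) :=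
    continuous_re.comp_continuousOn (hΦd.continuousOn.comp (by fun_prop) fun s hs => hray s hs.1)
  obtain ⟨s, ⟨hs0, hsS⟩, hs⟩ := intermediate_value_Icc hS hcont
    (show t * a ∈ Set.Icc _ _ by
      constructor
      · simp only [ofReal_zero, add_zero]
        nlinarith [ht.1]
      · have h1 := hΦl _ (hray _ hS)
        simp only [add_re, ofReal_re] at h1
        have h2 : l * (2 * R * a) ≤ l * (Φ (z₀ + (2 * l * R * a : ℝ))).re := by linarith
        have h3 := le_of_mul_le_mul_left h2 hl
        nlinarith [ht.2])
  have hz := hray s hs0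
  have hzx : (z₀ + (s : ℂ)).re = z₀.re + s := by simp
  set z := z₀ + (s : ℂ) with hzdef
  refine ⟨z, hs, ?_⟩
  have hX : ‖Φ z - Φ z₀‖ ≤ 2 * l * R ^ 2 / η * a := by
    have h1 := norm_sub_mul_norm_add_conj_le hΦd hΦm hz hz₀
    have h2 : z + (starRingEnd ℂ) z₀ = (2 * z₀.re + s : ℝ) := by
      rw [hzdef, add_right_comm, add_conj]; push_cast; ring
    have h3 : ‖z - z₀‖ = s := by
      rw [hzdef, add_sub_cancel_left, norm_real, Real.norm_of_nonneg hs0]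
    have h4 : ‖Φ z + (starRingEnd ℂ) (Φ z₀)‖ ≤ ‖Φ z - Φ z₀‖ + 2 * (R * a) := by
      have : Φ z + (starRingEnd ℂ) (Φ z₀) = (Φ z - Φ z₀) + (Φ z₀ + (starRingEnd ℂ) (Φ z₀)) := by
        ring
      rw [this]
      refine (norm_add_le _ _).trans ?_
      rw [add_conj, norm_real, Real.norm_of_nonneg (by positivity)]
      linarith
    rw [h2, h3, norm_real, Real.norm_of_nonneg (by positivity)] at h1
    have h5 := h1.trans (mul_le_mul_of_nonneg_left h4 hs0)
    have h6 : ‖Φ z - Φ z₀‖ * z₀.re ≤ s * (R * a) := by linarith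
    have h7 : ‖Φ z - Φ z₀‖ * (η * a) ≤ (2 * l * R * a) * (R * a) :=
      (mul_le_mul_of_nonneg_left hη₀ (norm_nonneg _)).trans
        (h6.trans (mul_le_mul_of_nonneg_right hsS (by positivity)))
    rw [← le_div_iff₀ (by positivity)] at h7
    refine h7.trans_eq ?_
    field_simp
  intro u hu
  rw [mem_ball_iff_norm] at hu
  have h1 := neg_le_of_abs_le (abs_re_le_norm (u - z))
  rw [sub_re, hzx] at h1
  have hux : η / 2 * a ≤ u.re := by linarith
  have hu' : u ∈ rightHalfPlane := lt_of_lt_of_le (by positivity) hux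
  refine ⟨hu', ?_, ?_⟩
  · have h2 := hΦl u hu'
    rw [← mul_le_mul_iff_right₀ hl]
    refine le_trans (le_of_eq ?_) (hux.trans h2)
    field_simp
  · have hY : ‖Φ u - Φ z‖ ≤ 2 * (t * a) := by
      have h2 := norm_sub_mul_norm_add_conj_le hΦd hΦm hu' hz
      have h3 : ‖Φ u + (starRingEnd ℂ) (Φ z)‖ ≤ ‖Φ u - Φ z‖ + 2 * (t * a) := by
        have : Φ u + (starRingEnd ℂ) (Φ z) = (Φ u - Φ z) + (Φ z + (starRingEnd ℂ) (Φ z)) := by ring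
        rw [this]
        refine (norm_add_le _ _).trans ?_
        have : 0 < t * a := mul_pos (by linarith [ht.1]) ha
        have hs' : (Φ z).re = t * a := hs
        rw [add_conj, hs', norm_real, Real.norm_of_nonneg (by positivity)]
      have h4 : z.re ≤ ‖u + (starRingEnd ℂ) z‖ := by
        refine le_trans ?_ (re_le_norm _)
        rw [add_re u, conj_re z]
        linarith [show 0 < u.re from hu']
      have h5 : ‖u - z‖ ≤ z.re / 2 := by linarith
      have h6 : ‖Φ u - Φ z‖ * z.re ≤ z.re / 2 * (‖Φ u - Φ z‖ + 2 * (t * a)) :=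
        (mul_le_mul_of_nonneg_left h4 (norm_nonneg _)).trans (h2.trans
          (mul_le_mul h5 h3 (norm_nonneg _) (by linarith)))
      have hz0 : 0 < z.re := hz
      nlinarith
    have h2 : Φ u - w = (Φ u - Φ z) + (Φ z - Φ z₀) + (Φ z₀ + (starRingEnd ℂ) w)
        - (w + (starRingEnd ℂ) w) := by ring
    rw [h2]
    refine (norm_sub_le _ _).trans ?_
    have h3 := norm_add₃_le (a := Φ u - Φ z) (b := Φ z - Φ z₀) (c := Φ z₀ + (starRingEnd ℂ) w)
    rw [add_conj, norm_real, Real.norm_of_nonneg (by positivity)]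
    have h4 : t * a ≤ 2 * R * a := mul_le_mul_of_nonneg_right ht.2 ha.le
    linarith

/-! ### A compactness argument for bounded holomorphic functions -/

open Filter Topology in
lemma exists_pos_norm_lt_one_of_small_values {U P : Set ℂ} (hU : IsOpen U)
    (hconn : IsPreconnected U) (hP : IsCompact P) (hPU : P ⊆ U) {c : ℂ} (hc : c ∈ U) {A : ℝ}
    (hA : 0 ≤ A) {T : Set ℝ} (hT : T.Infinite) :
    ∃ δ > 0, ∀ g : ℂ → ℂ, DifferentiableOn ℂ g U → (∀ z ∈ U, ‖g z‖ ≤ A) →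
      (∀ t ∈ T, ∃ p ∈ P, p.re = t ∧ ‖g p‖ ≤ δ) → ‖g c‖ < 1 := by
  by_contra! hcon
  choose g hgd hgA hgT hgc using fun n : ℕ => hcon (1 / ((n : ℝ) + 1)) (by positivity)
  set f : Ultrafilter ℕ := hyperfilter ℕ
  have hlim : ∀ z ∈ U, ∃ x, Tendsto (fun n => g n z) f (𝓝 x) := by
    intro z hz
    obtain ⟨x, -, hx⟩ := (isCompact_closedBall (0 : ℂ) A).ultrafilter_le_nhds
      (f.map fun n => g n z) (by
        rw [le_principal_iff]
        show (fun n => g n z) ⁻¹' closedBall 0 A ∈ (f : Filter ℕ)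
        exact Filter.univ_mem' fun n => mem_closedBall_zero_iff.2 (hgA n z hz))
    exact ⟨x, hx⟩
  choose! G hG using hlim
  have hloc : TendstoLocallyUniformlyOn g G f U := by
    rw [Metric.tendstoLocallyUniformlyOn_iff]
    intro ε hε x hx
    obtain ⟨r, hr, hrU⟩ := Metric.isOpen_iff.1 hU x hx
    have hlip : ∀ n, ∀ y ∈ ball x r, dist (g n y) (g n x) ≤ (2 * A + 1) / r * dist y x := by
      intro n y hy
      refine dist_le_div_mul_dist_of_mapsTo_ball ((hgd n).mono hrU) (fun u hu => ?_) hy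
      rw [mem_closedBall_iff_norm]
      refine (norm_sub_le _ _).trans ?_
      linarith [hgA n u (hrU hu), hgA n x hx]
    have hL : 0 < (2 * A + 1) / r := by positivity
    set L := (2 * A + 1) / r
    have hlip' : ∀ y ∈ ball x r, dist (G y) (G x) ≤ L * dist y x := fun y hy =>
      le_of_tendsto ((hG y (hrU hy)).dist (hG x hx))
        (Filter.Eventually.of_forall fun n => hlip n y hy)
    refine ⟨ball x (min r (ε / (3 * L))),
      mem_nhdsWithin_of_mem_nhds (ball_mem_nhds _ (by positivity)), ?_⟩
    filter_upwards [(Metric.tendsto_nhds.1 (hG x hx)) (ε / 3) (by positivity)] with n hn y hy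
    have hy1 : y ∈ ball x r := ball_subset_ball (min_le_left _ _) hy
    have hy2 : L * dist y x < ε / 3 := by
      have : dist y x < ε / (3 * L) := (mem_ball.1 hy).trans_le (min_le_right _ _)
      rw [lt_div_iff₀ (by positivity)] at this
      linarith
    have h1 := hlip n y hy1
    have h2 := hlip' y hy1
    rw [dist_comm] at h1 hn
    linarith [dist_triangle4 (G y) (G x) (g n x) (g n y)]
  have hGd : DifferentiableOn ℂ G U :=
    hloc.differentiableOn (Filter.Eventually.of_forall hgd) hU
  have hzero : ∀ t ∈ T, ∃ q ∈ P, q.re = t ∧ G q = 0 := by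
    intro t ht
    choose p hpP hpt hpg using fun n => hgT n t ht
    obtain ⟨q, hq, hpq⟩ := hP.ultrafilter_le_nhds (f.map p) (by
      rw [le_principal_iff]
      show p ⁻¹' P ∈ (f : Filter ℕ)
      exact Filter.univ_mem' hpP)
    have hpq : Tendsto p f (𝓝 q) := hpq
    have hqre : q.re = t := tendsto_nhds_unique ((continuous_re.tendsto q).comp hpq)
      (tendsto_const_nhds.congr fun n => (hpt n).symm)
    refine ⟨q, hq, hqre, ?_⟩
    have h1 : Tendsto (fun n => g n (p n)) f (𝓝 (G q)) :=
      hloc.tendsto_comp (hGd.continuousOn q (hPU hq)) (hPU hq)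
        (tendsto_nhdsWithin_iff.2 ⟨hpq, Filter.Eventually.of_forall fun n => hPU (hpP n)⟩)
    have h2 : Tendsto (fun n => g n (p n)) f (𝓝 0) :=
      squeeze_zero_norm hpg (tendsto_one_div_add_atTop_nhds_zero_nat.mono_left
        (Nat.hyperfilter_le_atTop))
    exact tendsto_nhds_unique h1 h2
  choose! q hqP hqre hqG using hzero
  have hinj : Set.InjOn q T := fun s hs t ht h => by rw [← hqre s hs, ← hqre t ht, h]
  obtain ⟨x, hx, hacc⟩ := (hT.image hinj).exists_accPt_of_subset_isCompact hP
    (Set.image_subset_iff.2 hqP)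
  have hG0 := (hGd.analyticOnNhd hU).eqOn_zero_of_preconnected_of_frequently_eq_zero hconn
    (hPU hx) ((accPt_iff_frequently_nhdsNE.1 hacc).mono fun y hy => by
      obtain ⟨t, ht, rfl⟩ := hy
      exact hqG t ht)
  have h1 : 1 ≤ ‖G c‖ := ge_of_tendsto (hG c hc).norm (Filter.Eventually.of_forall hgc)
  rw [hG0 hc] at h1
  simp at h1
  linarith
/-! ### Local and global estimates -/

/-- A hyperbolic neighbourhood of `w`, of size controlled by `K`. -/
def hpNhd (K : ℝ) (w : ℂ) : Set ℂ := {s | w.re ≤ K * s.re ∧ ‖s - w‖ ≤ K * w.re}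

lemma isClosed_hpNhd_graph (K : ℝ) : IsClosed {p : ℂ × ℂ | p.2 ∈ hpNhd K p.1} := by
  have h1 : IsClosed {p : ℂ × ℂ | p.1.re ≤ K * p.2.re} :=
    isClosed_le (by fun_prop) (by fun_prop)
  have h2 : IsClosed {p : ℂ × ℂ | ‖p.2 - p.1‖ ≤ K * p.1.re} :=
    isClosed_le (by fun_prop) (by fun_prop)
  exact h1.inter h2

lemma isClosed_hpNhd (K : ℝ) (w : ℂ) : IsClosed (hpNhd K w) :=
  (isClosed_hpNhd_graph K).preimage (f := fun s : ℂ => (w, s)) (by fun_prop)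

lemma lintegral_hpNhd_le {K : ℝ} (hK : 0 < K) {s : ℂ} (hs : s ∈ rightHalfPlane) :
    ∫⁻ w in rightHalfPlane, {w | s ∈ hpNhd K w}.indicator
      (fun w => ENNReal.ofReal (1 / w.re ^ 2)) w ≤
        ENNReal.ofReal ((K + 1) ^ 2 * K ^ 4 * Real.pi) := by
  have hs' : 0 < s.re := hs
  have h1 : ∀ w ∈ rightHalfPlane, {w | s ∈ hpNhd K w}.indicator
      (fun w => ENNReal.ofReal (1 / w.re ^ 2)) w ≤ (closedBall s (K ^ 2 * s.re)).indicator
      (fun _ => ENNReal.ofReal ((K + 1) ^ 2 / s.re ^ 2)) w := by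
    intro w hw
    have hw' : 0 < w.re := hw
    by_cases h : s ∈ hpNhd K w
    · have hmem : w ∈ closedBall s (K ^ 2 * s.re) := by
        rw [mem_closedBall_iff_norm, norm_sub_rev]
        nlinarith [h.1, h.2]
      rw [Set.indicator_of_mem (by exact h), Set.indicator_of_mem hmem]
      apply ENNReal.ofReal_le_ofReal
      have hle : s.re ≤ (K + 1) * w.re := by
        have := (abs_le.1 ((abs_re_le_norm (s - w)).trans h.2)).2
        rw [sub_re] at this
        linarith
      rw [div_le_div_iff₀ (by positivity) (by positivity), one_mul, ← mul_pow]
      gcongr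
    · rw [Set.indicator_of_notMem (by exact h)]
      exact zero_le
  refine (setLIntegral_mono' isOpen_rightHalfPlane.measurableSet h1).trans ?_
  refine (setLIntegral_le_lintegral _ _).trans_eq ?_
  calc
    _ = ENNReal.ofReal ((K + 1) ^ 2 / s.re ^ 2) *
        (ENNReal.ofReal (K ^ 2 * s.re) ^ 2 * NNReal.pi) := by
      rw [lintegral_indicator measurableSet_closedBall, setLIntegral_const,
        Complex.volume_closedBall]
    _ = ENNReal.ofReal ((K + 1) ^ 2 * K ^ 4 * Real.pi) := by
      rw [← ENNReal.ofReal_pow (by positivity), ← ENNReal.ofReal_coe_nnreal, NNReal.coe_real_pi,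
        ← ENNReal.ofReal_mul (by positivity), ← ENNReal.ofReal_mul (by positivity)]
      congr 1
      field_simp

lemma measurableSet_inter_preimage_hpNhd {Ψ : ℂ → ℂ} (hΨ : ContinuousOn Ψ rightHalfPlane) (K : ℝ)
    (w : ℂ) : MeasurableSet (rightHalfPlane ∩ Ψ ⁻¹' hpNhd K w) := by
  obtain ⟨u, hu, h⟩ := continuousOn_iff_isClosed.1 hΨ _ (isClosed_hpNhd K w)
  rw [Set.inter_comm, h]
  exact hu.measurableSet.inter isOpen_rightHalfPlane.measurableSet

lemma measurable_and_lintegral_lintegral_preimage_hpNhd_le {Ψ G : ℂ → ℂ}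
    (hΨ : ContinuousOn Ψ rightHalfPlane)
    (hΨm : Set.MapsTo Ψ rightHalfPlane rightHalfPlane) (hG : ContinuousOn G rightHalfPlane)
    {K : ℝ} (hK : 0 < K) :
    Measurable (fun w : ℂ => ENNReal.ofReal (1 / w.re ^ 2) *
      ∫⁻ z in rightHalfPlane ∩ Ψ ⁻¹' hpNhd K w, ‖G z‖ₑ ^ 2) ∧
    ∫⁻ w in rightHalfPlane, ENNReal.ofReal (1 / w.re ^ 2) *
      ∫⁻ z in rightHalfPlane ∩ Ψ ⁻¹' hpNhd K w, ‖G z‖ₑ ^ 2 ≤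
      ENNReal.ofReal ((K + 1) ^ 2 * K ^ 4 * Real.pi) * ∫⁻ z in rightHalfPlane, ‖G z‖ₑ ^ 2 := by
  classical
  have hH := isOpen_rightHalfPlane.measurableSet
  set Ψ' : ℂ → ℂ := rightHalfPlane.piecewise Ψ fun _ => 0
  have hΨ' : Measurable Ψ' := hΨ.measurable_piecewise continuousOn_const hH
  set g : ℂ → ENNReal := rightHalfPlane.indicator fun z => ‖G z‖ₑ ^ 2
  have hg : Measurable g := measurable_indicator_enorm_sq hH hG
  have hS : MeasurableSet {p : ℂ × ℂ | Ψ' p.2 ∈ hpNhd K p.1} :=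
    (isClosed_hpNhd_graph K).measurableSet.preimage
      (measurable_fst.prodMk (hΨ'.comp measurable_snd))
  set k : ℂ → ℂ → ENNReal := fun w z => {w | Ψ' z ∈ hpNhd K w}.indicator
    (fun w => ENNReal.ofReal (1 / w.re ^ 2)) w
  have hk : Measurable (Function.uncurry k) :=
    (show Measurable fun p : ℂ × ℂ => ENNReal.ofReal (1 / p.1.re ^ 2) by fun_prop).indicator hS
  have h1 : ∀ w, ENNReal.ofReal (1 / w.re ^ 2) *
      ∫⁻ z in rightHalfPlane ∩ Ψ ⁻¹' hpNhd K w, ‖G z‖ₑ ^ 2 =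
      ∫⁻ z in rightHalfPlane, k w z * g z := by
    intro w
    rw [← lintegral_indicator (measurableSet_inter_preimage_hpNhd hΨ K w),
      ← lintegral_const_mul' _ _ ENNReal.ofReal_ne_top, ← lintegral_indicator hH]
    congr 1 with z
    by_cases hz : z ∈ rightHalfPlane
    · have hz' : Ψ' z = Ψ z := Set.piecewise_eq_of_mem _ _ _ hz
      rw [Set.indicator_of_mem hz]
      by_cases hzw : Ψ z ∈ hpNhd K w
      · simp only [k, g]
        rw [Set.indicator_of_mem (Set.mem_inter hz (Set.mem_preimage.2 hzw)),
          Set.indicator_of_mem hz, Set.indicator_of_mem (by rw [Set.mem_ofPred_eq, hz']; exact hzw)]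
      · simp only [k]
        rw [Set.indicator_of_notMem (fun h => hzw h.2),
          Set.indicator_of_notMem (by rw [Set.mem_ofPred_eq, hz']; exact hzw)]
        simp
    · rw [Set.indicator_of_notMem hz, Set.indicator_of_notMem (fun h => hz h.1), mul_zero]
  simp_rw [h1]
  refine ⟨(hk.mul (hg.comp measurable_snd)).lintegral_prod_right', ?_⟩
  rw [lintegral_lintegral_swap (hk.mul (hg.comp measurable_snd)).aemeasurable,
    ← lintegral_const_mul' _ _ ENNReal.ofReal_ne_top]
  refine setLIntegral_mono' hH fun z hz => ?_
  rw [lintegral_mul_const _ (show Measurable fun w => k w z from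
    hk.comp (measurable_id.prodMk measurable_const))]
  simp only [g]
  rw [Set.indicator_of_mem hz]
  gcongr
  have hz' : Ψ' z ∈ rightHalfPlane := by
    rw [show Ψ' z = Ψ z from Set.piecewise_eq_of_mem _ _ _ hz]
    exact hΨm hz
  exact lintegral_hpNhd_le hK hz'

lemma enorm_sq_le_of_norm_sq_le {x y : ℂ} {c k : ℝ} {I : ENNReal} (hc : 0 ≤ c) (hk : 0 ≤ k)
    (hI : ENNReal.ofReal c * ‖y‖ₑ ^ 2 ≤ I) (h : ‖x‖ ^ 2 ≤ k * c * ‖y‖ ^ 2) :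
    ‖x‖ₑ ^ 2 ≤ ENNReal.ofReal k * I := by
  have hx : ∀ u : ℂ, ‖u‖ₑ ^ 2 = ENNReal.ofReal (‖u‖ ^ 2) := fun u => by
    rw [ENNReal.ofReal_pow (norm_nonneg _), ofReal_norm]
  calc ‖x‖ₑ ^ 2 ≤ ENNReal.ofReal (k * c * ‖y‖ ^ 2) := by
        rw [hx]; exact ENNReal.ofReal_le_ofReal h
    _ = ENNReal.ofReal k * (ENNReal.ofReal c * ‖y‖ₑ ^ 2) := by
        rw [hx, ← ENNReal.ofReal_mul hc, ← ENNReal.ofReal_mul hk, mul_assoc]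
    _ ≤ _ := by gcongr

lemma exists_enorm_sq_le_lintegral_hpNhd {Φ : ℂ → ℂ} (hΦd : DifferentiableOn ℂ Φ rightHalfPlane)
    (hΦm : Set.MapsTo Φ rightHalfPlane rightHalfPlane) {l η R : ℝ} (hl : 0 < l)
    (hΦl : ∀ z ∈ rightHalfPlane, z.re ≤ l * (Φ z).re) (hη : 0 < η) (hR : 1 ≤ R) :
    ∃ K > 0, ∀ ε > 0, ∃ C ≥ 0, ∀ w ∈ rightHalfPlane,
      (∃ z₀ ∈ rightHalfPlane, η * w.re ≤ z₀.re ∧ ‖Φ z₀ + (starRingEnd ℂ) w‖ ≤ R * w.re) →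
      ∀ F : ℂ → ℂ, DifferentiableOn ℂ F rightHalfPlane →
        ‖F w‖ₑ ^ 2 ≤ ENNReal.ofReal (1 / w.re ^ 2) *
          (ENNReal.ofReal ε * (∫⁻ z in rightHalfPlane ∩ id ⁻¹' hpNhd K w, ‖F z‖ₑ ^ 2) +
            ENNReal.ofReal C * ∫⁻ z in rightHalfPlane ∩ Φ ⁻¹' hpNhd K w, ‖F (Φ z)‖ₑ ^ 2) := by
  set K₁ := 2 * l * R ^ 2 / η + 5 * R + 2 with hK₁
  have hK₁pos : 0 < K₁ := by positivity
  have hlη : 0 < 2 * l / η := by positivity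
  refine ⟨K₁ + 6 + 2 * l / η, by positivity, fun ε hε => ?_⟩
  set K := K₁ + 6 + 2 * l / η with hK
  set U : Set ℂ := {p | 1 / 2 < p.re} ∩ ball 1 (K₁ + 1) with hUdef
  set P : Set ℂ := closedBall 1 K₁ ∩ re ⁻¹' Set.Icc R (2 * R) with hPdef
  have hU : IsOpen U := (isOpen_lt continuous_const continuous_re).inter isOpen_ball
  have hUc : IsPreconnected U :=
    ((convex_halfSpace_re_gt (1 / 2)).inter (convex_ball 1 (K₁ + 1))).isPreconnected
  have hP : IsCompact P :=
    (isCompact_closedBall 1 K₁).inter_right (isClosed_Icc.preimage continuous_re)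
  have hPU : P ⊆ U := by
    rintro p ⟨h1, h2⟩
    refine ⟨?_, ?_⟩
    · show 1 / 2 < p.re
      linarith [h2.1]
    · exact closedBall_subset_ball (by linarith) h1
  have honeU : (1 : ℂ) ∈ U := ⟨by norm_num, mem_ball_self (by linarith)⟩
  set A := √(16 / (Real.pi * ε)) with hA
  have hA2 : A ^ 2 = 16 / (Real.pi * ε) := Real.sq_sqrt (by positivity)
  obtain ⟨δ, hδ, hsmall⟩ := exists_pos_norm_lt_one_of_small_values hU hUc hP hPU honeU
    (Real.sqrt_nonneg (16 / (Real.pi * ε))) (Set.Icc_infinite (show R < 2 * R by linarith))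
  refine ⟨4 / (Real.pi * η ^ 2 * δ ^ 2), by positivity, fun w hw ⟨z₀, hz₀, hη₀, hR₀⟩ F hF => ?_⟩
  have ha : 0 < w.re := hw
  rcases eq_or_ne (F w) 0 with hm | hm
  · simp [hm]
  have hm' : 0 < ‖F w‖ := norm_pos_iff.2 hm
  set L : ℂ → ℂ := fun p => w.re * p + w.im * I with hL
  have hLw : L 1 = w := by simp [hL]
  have hLre : ∀ p, (L p).re = w.re * p.re := fun p => by simp [hL]
  have hLsub : ∀ p, ‖L p - w‖ = w.re * ‖p - 1‖ := fun p => by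
    have h : L p - w = w.re * (p - 1) := by
      show (w.re : ℂ) * p + w.im * I - w = w.re * (p - 1)
      linear_combination re_add_im w
    rw [h, norm_mul, norm_real, Real.norm_of_nonneg ha.le]
  have hLH : ∀ p ∈ U, L p ∈ rightHalfPlane := fun p hp => by
    show 0 < (L p).re
    rw [hLre]
    have : 1 / 2 < p.re := hp.1
    positivity
  have hmain : ∀ k ≥ 0, ∀ (S : Set ℂ) (G : ℂ → ℂ) (c : ℂ) (r : ℝ), 0 < r → ball c r ⊆ S →
      DifferentiableOn ℂ G (ball c r) → ‖F w‖ ^ 2 ≤ k / w.re ^ 2 * (Real.pi * r ^ 2) * ‖G c‖ ^ 2 →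
      ‖F w‖ₑ ^ 2 ≤ ENNReal.ofReal (1 / w.re ^ 2) *
        (ENNReal.ofReal k * ∫⁻ z in S, ‖G z‖ₑ ^ 2) := by
    intro k hk S G c r hr hS hG h
    rw [← mul_assoc, ← ENNReal.ofReal_mul (by positivity), one_div_mul_eq_div]
    exact enorm_sq_le_of_norm_sq_le (by positivity) (by positivity)
      ((enorm_sq_le_lintegral_ball hr hG).trans (lintegral_mono_set hS)) h
  by_cases hbd : ∀ p ∈ U, ‖F (L p)‖ ≤ A * ‖F w‖
  · obtain ⟨t, ht, hlarge⟩ : ∃ t ∈ Set.Icc R (2 * R), ∀ p ∈ P, p.re = t →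
        δ < ‖F (L p) / F w‖ := by
      by_contra! hcon
      refine absurd (hsmall (fun p => F (L p) / F w) ?_ ?_ hcon) ?_
      · exact (hF.comp (by simp only [hL]; fun_prop) hLH).div_const _
      · intro p hp
        rw [norm_div, div_le_iff₀ hm']
        exact hbd p hp
      · simp [hLw, div_self hm]
    obtain ⟨z, hz, hball⟩ := exists_re_eq_and_mapsTo hΦd hΦm hl hΦl hη hR hw hz₀ hη₀ hR₀ ht
    have hr : 0 < η / 2 * w.re := by positivity
    obtain ⟨hzH, -, hzK⟩ := hball z (mem_ball_self hr)
    set p : ℂ := (Φ z - w.im * I) / w.re with hp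
    have hLp : L p = Φ z := by
      have : (w.re : ℂ) ≠ 0 := by exact_mod_cast ha.ne'
      simp only [hL, hp]
      field_simp
      ring
    have hpre : p.re = t := by
      have := hLre p
      rw [hLp, hz] at this
      nlinarith
    have hpP : p ∈ P := by
      refine ⟨?_, by rw [Set.mem_preimage, hpre]; exact ht⟩
      rw [mem_closedBall_iff_norm]
      have := hLsub p
      rw [hLp] at this
      rw [this] at hzK
      nlinarith
    have hlt := hlarge p hpP hpre
    rw [norm_div, lt_div_iff₀ hm', hLp] at hlt
    refine (hmain _ (by positivity) (rightHalfPlane ∩ Φ ⁻¹' hpNhd K w) (fun s => F (Φ s)) z _ hr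
      (fun s hs => ?_) ?_ ?_).trans (mul_le_mul_right le_add_self _)
    · obtain ⟨h1, h2, h3⟩ := hball s hs
      have h4 : w.re ≤ 2 * l / η * (Φ s).re := by
        rw [div_mul_eq_mul_div, div_le_iff₀ (by positivity)] at h2
        rw [div_mul_eq_mul_div, le_div_iff₀ hη]
        linarith
      have h5 : 0 < (Φ s).re := hΦm h1
      refine ⟨h1, ?_, ?_⟩
      · nlinarith
      · nlinarith
    · exact hF.comp (hΦd.mono fun s hs => (hball s hs).1) fun s hs => hΦm (hball s hs).1
    · have : 4 / (Real.pi * η ^ 2 * δ ^ 2) / w.re ^ 2 * (Real.pi * (η / 2 * w.re) ^ 2) =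
          1 / δ ^ 2 := by
        have := Real.pi_ne_zero
        field_simp
        norm_num
      rw [this, one_div_mul_eq_div, le_div_iff₀ (by positivity), ← mul_pow]
      gcongr
      linarith
  · push Not at hbd
    obtain ⟨p, hp, hlt⟩ := hbd
    have hpre : 1 / 2 < p.re := hp.1
    have hpn : ‖p - 1‖ < K₁ + 1 := mem_ball_iff_norm.1 hp.2
    have hball : ball (L p) (w.re / 4) ⊆ rightHalfPlane ∩ id ⁻¹' hpNhd K w := by
      intro s hs
      rw [mem_ball_iff_norm] at hs
      have h1 : w.re / 4 < s.re := by
        have := (abs_lt.1 ((abs_re_le_norm _).trans_lt hs)).1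
        rw [sub_re, hLre] at this
        nlinarith
      have h2 : ‖s - w‖ ≤ w.re / 4 + w.re * (K₁ + 1) := by
        refine (norm_sub_le_norm_sub_add_norm_sub s (L p) w).trans ?_
        rw [hLsub]
        nlinarith
      refine ⟨show 0 < s.re by linarith, ?_, ?_⟩
      · show w.re ≤ K * s.re
        nlinarith
      · show ‖s - w‖ ≤ K * w.re
        nlinarith
    refine (hmain _ hε.le (rightHalfPlane ∩ id ⁻¹' hpNhd K w) F (L p) (w.re / 4) (by positivity)
      hball (hF.mono fun s hs => (hball hs).1) ?_).trans (mul_le_mul_right le_self_add _)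
    have h1 : ε / w.re ^ 2 * (Real.pi * (w.re / 4) ^ 2) = 1 / A ^ 2 := by
      rw [hA2]
      field_simp
      norm_num
    have hApos : 0 < A := Real.sqrt_pos.2 (by positivity)
    rw [h1, one_div_mul_eq_div, le_div_iff₀ (by positivity), ← mul_pow]
    gcongr
    linarith

lemma ofReal_le_lintegral_of_le_hpBergNorm {Φ : ℂ → ℂ} {w : ℂ} (hw : 0 < w.re)
    (hmem : MemA2Plane fun s => hpKernel w (Φ s)) {C : ℝ} (hC : 0 ≤ C)
    (h : C ≤ hpBergNorm fun s => bergKtildePlane w (Φ s)) :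
    ENNReal.ofReal (C ^ 2 * hpBergNorm (hpKernel 1) ^ 2) ≤ ∫⁻ z in rightHalfPlane,
      ENNReal.ofReal (w.re ^ 2 / ‖Φ z + (starRingEnd ℂ) w‖ ^ 4) := by
  have hN := hpBergNorm_hpKernel_pos hw
  simp_rw [bergKtildePlane_eq] at h
  rw [hpBergNorm_const_mul, abs_of_pos (inv_pos.2 hN), inv_mul_eq_div, le_div_iff₀ hN] at h
  have h2 := pow_le_pow_left₀ (by positivity) h 2
  rw [mul_pow, hpBergNorm_hpKernel_sq hw, ← mul_div_assoc, div_le_iff₀ (by positivity)] at h2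
  calc ENNReal.ofReal (C ^ 2 * hpBergNorm (hpKernel 1) ^ 2)
      ≤ ENNReal.ofReal (w.re ^ 2 * hpBergNorm (fun s => hpKernel w (Φ s)) ^ 2) :=
        ENNReal.ofReal_le_ofReal (by linarith)
    _ = ∫⁻ z in rightHalfPlane, ENNReal.ofReal (w.re ^ 2) * ‖hpKernel w (Φ z)‖ₑ ^ 2 := by
        rw [lintegral_const_mul' _ _ ENNReal.ofReal_ne_top, lintegral_enorm_sq_eq hmem,
          ENNReal.ofReal_mul (by positivity)]
    _ = _ := lintegral_congr fun z => by
        rw [← ofReal_norm, ← ENNReal.ofReal_pow (norm_nonneg _), norm_hpKernel_sq,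
          ← ENNReal.ofReal_mul (by positivity), div_eq_mul_inv]

lemma exists_hpBergNorm_le_of_forall_exists {Φ : ℂ → ℂ}
    (hΦd : DifferentiableOn ℂ Φ rightHalfPlane)
    (hΦm : Set.MapsTo Φ rightHalfPlane rightHalfPlane) {l η R : ℝ} (hl : 0 < l)
    (hΦl : ∀ z ∈ rightHalfPlane, z.re ≤ l * (Φ z).re) (hη : 0 < η) (hR : 1 ≤ R)
    (hz₀ : ∀ w ∈ rightHalfPlane, ∃ z₀ ∈ rightHalfPlane, η * w.re ≤ z₀.re ∧
      ‖Φ z₀ + (starRingEnd ℂ) w‖ ≤ R * w.re) :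
    ∃ δ > 0, ∀ F : ℂ → ℂ, MemA2Plane F → MemA2Plane (fun s => F (Φ s)) →
      δ * hpBergNorm F ≤ hpBergNorm (fun s => F (Φ s)) := by
  obtain ⟨K, hK, hlocal⟩ := exists_enorm_sq_le_lintegral_hpNhd hΦd hΦm hl hΦl hη hR
  set B := (K + 1) ^ 2 * K ^ 4 * Real.pi with hB
  have hBpos : 0 < B := by positivity
  obtain ⟨C, hC, hest⟩ := hlocal (1 / (2 * B)) (by positivity)
  have hD : 0 < 2 * C * B + 1 := by positivity
  refine ⟨1 / √(2 * C * B + 1), by positivity, fun F hF hFΦ => ?_⟩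
  obtain ⟨hm, h1⟩ := measurable_and_lintegral_lintegral_preimage_hpNhd_le continuousOn_id
    (Set.mapsTo_id _) hF.1.continuousOn hK
  obtain ⟨-, h2⟩ := measurable_and_lintegral_lintegral_preimage_hpNhd_le hΦd.continuousOn hΦm
    hFΦ.1.continuousOn hK
  have key : ENNReal.ofReal (hpBergNorm F ^ 2) ≤
      ENNReal.ofReal (1 / (2 * B)) * (ENNReal.ofReal B * ENNReal.ofReal (hpBergNorm F ^ 2)) +
      ENNReal.ofReal C * (ENNReal.ofReal B *
        ENNReal.ofReal (hpBergNorm (fun s => F (Φ s)) ^ 2)) := by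
    rw [← lintegral_enorm_sq_eq hF, ← lintegral_enorm_sq_eq hFΦ]
    refine (setLIntegral_mono' isOpen_rightHalfPlane.measurableSet
      fun w hw => hest w hw (hz₀ w hw) F hF.1).trans ?_
    simp_rw [mul_add, mul_left_comm (ENNReal.ofReal (1 / _ ^ 2))]
    rw [lintegral_add_left (hm.const_mul _), lintegral_const_mul' _ _ ENNReal.ofReal_ne_top,
      lintegral_const_mul' _ _ ENNReal.ofReal_ne_top]
    gcongr
  rw [← ENNReal.ofReal_mul hBpos.le, ← ENNReal.ofReal_mul hBpos.le,
    ← ENNReal.ofReal_mul (by positivity), ← ENNReal.ofReal_mul hC,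
    ← ENNReal.ofReal_add (by positivity) (by positivity),
    ENNReal.ofReal_le_ofReal_iff (by positivity)] at key
  have hhalf : 1 / (2 * B) * (B * hpBergNorm F ^ 2) = hpBergNorm F ^ 2 / 2 := by
    field_simp
  rw [hhalf] at key
  rw [one_div_mul_eq_div, div_le_iff₀ (by positivity)]
  refine (sq_le_sq₀ (hpBergNorm_nonneg _) (mul_nonneg (hpBergNorm_nonneg _)
    (Real.sqrt_nonneg _))).1 ?_
  rw [mul_pow, Real.sq_sqrt hD.le]
  nlinarith [sq_nonneg (hpBergNorm fun s => F (Φ s))]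

lemma memA2Plane_bergKtildePlane {w : ℂ} (hw : 0 < w.re) : MemA2Plane (bergKtildePlane w) := by
  rw [show bergKtildePlane w = _ from funext (bergKtildePlane_eq w)]
  exact (memA2Plane_hpKernel hw).const_mul _

lemma hpBergNorm_bergKtildePlane {w : ℂ} (hw : 0 < w.re) :
    hpBergNorm (bergKtildePlane w) = 1 := by
  have hN := hpBergNorm_hpKernel_pos hw
  rw [show bergKtildePlane w = _ from funext (bergKtildePlane_eq w), hpBergNorm_const_mul,
    abs_of_pos (inv_pos.2 hN), inv_mul_cancel₀ hN.ne']

/-- If `Φ : ℂ₊ → ℂ₊` is holomorphic and `C_Φ` is bounded on `A²(ℂ₊)`, then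
`C_Φ` is bounded below iff there is `C > 0` with `‖C_Φ K̃_w‖ ≥ C` for all `w ∈ ℂ₊`. -/
theorem statement_10 (Φ : ℂ → ℂ)
    (hΦd : DifferentiableOn ℂ Φ {s : ℂ | 0 < s.re})
    (hΦm : Set.MapsTo Φ {s : ℂ | 0 < s.re} {s : ℂ | 0 < s.re})
    (hbdd : ∃ M > (0 : ℝ), ∀ F : ℂ → ℂ, MemA2Plane F →
      MemA2Plane (fun s => F (Φ s)) ∧
      hpBergNorm (fun s => F (Φ s)) ≤ M * hpBergNorm F) :
    (∃ δ > (0 : ℝ), ∀ F : ℂ → ℂ, MemA2Plane F →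
        δ * hpBergNorm F ≤ hpBergNorm (fun s => F (Φ s))) ↔
    (∃ C > (0 : ℝ), ∀ w : ℂ, 0 < w.re →
        C ≤ hpBergNorm (fun s => bergKtildePlane w (Φ s))) := by
  obtain ⟨M, hM, hbdd⟩ := hbdd
  constructor
  · rintro ⟨δ, hδ, h⟩
    refine ⟨δ, hδ, fun w hw => ?_⟩
    simpa [hpBergNorm_bergKtildePlane hw] using h _ (memA2Plane_bergKtildePlane hw)
  · rintro ⟨C, hC, h⟩
    have hκ := hpBergNorm_hpKernel_one_pos
    obtain ⟨l, hl, hΦl⟩ := exists_re_le_mul_re hΦm hM hbdd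
    obtain ⟨η, hη, R, hR, hz₀⟩ := exists_re_ge_and_norm_le hΦd hΦm hl hΦl
      (show 0 < C ^ 2 * hpBergNorm (hpKernel 1) ^ 2 by positivity)
    obtain ⟨δ, hδ, hδF⟩ := exists_hpBergNorm_le_of_forall_exists hΦd hΦm hl hΦl hη hR
      fun w hw => hz₀ w hw (ofReal_le_lintegral_of_le_hpBergNorm hw
        (hbdd _ (memA2Plane_hpKernel hw)).1 hC.le (h w hw))
    exact ⟨δ, hδ, fun F hF => hδF F hF (hbdd F hF).1⟩

end
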